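/- (Double-sum rearrangement over process sets, Equation 9.) For every function f : {1,…,k} × ℕ → ℝ, letting t_max = max_{1≤i≤k} len(g_i): ∑_{i=1}^k ∑_{t=0}^{len(g_i)−1} f(i,t) = ∑_{t=0}^{t_max−1} ∑_{λ∈X_t} ∑_{i∈λ} f(i,t). -/

import Mathlib

/-- `nodeG g p` is the set of indices `i` such that `p` is a prefix of the trajectory `g i`. -/
noncomputable def nodeG {α : Type*} {k : ℕ} (g : Fin k → List α) (p : List α) :
    Finset (Fin k) :=
  @Finset.filter _ (fun i => p <+: g i) (Classical.decPred _) Finset.univ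

/-- `BG g` is the family of process sets: nonempty sets of the form `nodeG g p`. -/
def BG {α : Type*} {k : ℕ} (g : Fin k → List α) : Set (Finset (Fin k)) :=
  {L | ∃ p : List α, (nodeG g p).Nonempty ∧ nodeG g p = L}

/-- `eG g L` is the length of the longest common prefix of the trajectories `g i`, `i ∈ L`. -/
noncomputable def eG {α : Type*} {k : ℕ} (g : Fin k → List α) (L : Finset (Fin k)) : ℕ :=
  sSup {n : ℕ | ∃ p : List α, p.length = n ∧ ∀ i ∈ L, p <+: g i}

-- The immediate parent of a process set: its least strict superset in `BG g`.
open Classical in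
noncomputable def parentG {α : Type*} {k : ℕ} (g : Fin k → List α) (L : Finset (Fin k)) :
    Finset (Fin k) :=
  if h : ∃ M, M ∈ BG g ∧ L ⊂ M ∧ ∀ M' ∈ BG g, L ⊂ M' → M ⊆ M' then h.choose
  else Finset.univ

/-- Start index of the process step of `L`: `0` for the root, `eG g (parentG g L)` otherwise. -/
noncomputable def sG {α : Type*} {k : ℕ} (g : Fin k → List α) (L : Finset (Fin k)) : ℕ :=
  if L = Finset.univ then 0 else eG g (parentG g L)

/-- `XtG g t` is the family of process sets whose token span contains the index `t`. -/
noncomputable def XtG {α : Type*} {k : ℕ} (g : Fin k → List α) (t : ℕ) :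
    Finset (Finset (Fin k)) :=
  @Finset.filter _ (fun L => L ∈ BG g ∧ sG g L ≤ t ∧ t < eG g L)
    (Classical.decPred _) Finset.univ

/-- Mean of the rewards. -/
noncomputable def rmeanG {k : ℕ} (r : Fin k → ℝ) : ℝ := (∑ i, r i) / k

/-- Standard deviation of the rewards. -/
noncomputable def rstdG {k : ℕ} (r : Fin k → ℝ) : ℝ :=
  Real.sqrt ((∑ i, (r i - rmeanG r) ^ 2) / k)

/-- Outcome-level advantage `a_i`. -/
noncomputable def advG {k : ℕ} (r : Fin k → ℝ) (i : Fin k) : ℝ :=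
  (r i - rmeanG r) / rstdG r

/-- Step-level reward `R̂(λ)`. -/
noncomputable def RhatG {k : ℕ} (r : Fin k → ℝ) (L : Finset (Fin k)) : ℝ :=
  (∑ i ∈ L, r i) / L.card

/-- Step-level advantage `Â(λ)`. -/
noncomputable def AhatG {k : ℕ} (r : Fin k → ℝ) (L : Finset (Fin k)) : ℝ :=
  (RhatG r L - rmeanG r) / rstdG r

theorem mem_nodeG {α : Type*} {k : ℕ} {g : Fin k → List α} {p : List α} {i : Fin k} :
    i ∈ nodeG g p ↔ p <+: g i := by
  simp [nodeG]

theorem le_eG_iff {α : Type*} {k : ℕ} {g : Fin k → List α} {L : Finset (Fin k)} {i : Fin k}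
    (hi : i ∈ L) {n : ℕ} :
    n ≤ eG g L ↔ n ≤ (g i).length ∧ L ⊆ nodeG g ((g i).take n) := by
  have hbdd : BddAbove {n : ℕ | ∃ p : List α, p.length = n ∧ ∀ i ∈ L, p <+: g i} := by
    refine ⟨(g i).length, ?_⟩
    rintro _ ⟨p, rfl, hp⟩
    exact (hp i hi).length_le
  constructor
  · intro hn
    obtain ⟨p, hpe, hp⟩ : eG g L ∈ {n : ℕ | ∃ p : List α, p.length = n ∧ ∀ i ∈ L, p <+: g i} :=
      Nat.sSup_mem ⟨0, [], rfl, fun _ _ => List.nil_prefix⟩ hbdd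
    have hnp : n ≤ p.length := hpe ▸ hn
    refine ⟨hnp.trans (hp i hi).length_le, fun j hj => mem_nodeG.2 ?_⟩
    have htake : (g i).take n <+: p :=
      List.prefix_of_prefix_length_le (List.take_prefix _ _) (hp i hi)
        ((List.length_take_le _ _).trans hnp)
    exact htake.trans (hp j hj)
  · rintro ⟨hn, hL⟩
    exact le_csSup hbdd ⟨(g i).take n, by simpa using hn, fun j hj => mem_nodeG.1 (hL hj)⟩

theorem nodeG_subset_nodeG {α : Type*} {k : ℕ} {g : Fin k → List α} {p q : List α}
    (h : p <+: q) : nodeG g q ⊆ nodeG g p :=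
  fun _ hi => mem_nodeG.2 (h.trans (mem_nodeG.1 hi))

theorem subset_total_of_mem_BG {α : Type*} {k : ℕ} {g : Fin k → List α} {L M : Finset (Fin k)}
    (hL : L ∈ BG g) (hM : M ∈ BG g) {i : Fin k} (hiL : i ∈ L) (hiM : i ∈ M) :
    L ⊆ M ∨ M ⊆ L := by
  obtain ⟨p, -, rfl⟩ := hL
  obtain ⟨q, -, rfl⟩ := hM
  exact (List.prefix_or_prefix_of_prefix (mem_nodeG.1 hiL) (mem_nodeG.1 hiM)).symm.imp
    nodeG_subset_nodeG nodeG_subset_nodeG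

theorem univ_mem_BG {α : Type*} {k : ℕ} (g : Fin k → List α) (i : Fin k) :
    Finset.univ ∈ BG g :=
  ⟨[], ⟨i, mem_nodeG.2 List.nil_prefix⟩,
    Finset.eq_univ_of_forall fun _ => mem_nodeG.2 List.nil_prefix⟩

theorem parentG_spec {α : Type*} {k : ℕ} {g : Fin k → List α} {L : Finset (Fin k)} {i : Fin k}
    (hi : i ∈ L) (hL : L ≠ Finset.univ) :
    parentG g L ∈ BG g ∧ L ⊂ parentG g L ∧ ∀ M ∈ BG g, L ⊂ M → parentG g L ⊆ M := by
  have h : ∃ M, M ∈ BG g ∧ L ⊂ M ∧ ∀ M' ∈ BG g, L ⊂ M' → M ⊆ M' := by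
    obtain ⟨M, ⟨hM, hLM⟩, hmin⟩ :=
      Set.exists_min_image {M | M ∈ BG g ∧ L ⊂ M} Finset.card (Set.toFinite _)
        ⟨Finset.univ, univ_mem_BG g i, Finset.ssubset_univ_iff.2 hL⟩
    refine ⟨M, hM, hLM, fun M' hM' hLM' => ?_⟩
    rcases subset_total_of_mem_BG hM hM' (hLM.1 hi) (hLM'.1 hi) with h | h
    · exact h
    · exact (Finset.eq_of_subset_of_card_le h (hmin M' ⟨hM', hLM'⟩)).ge
  rw [parentG, dif_pos h]
  exact h.choose_spec

theorem mem_XtG_iff_eq_nodeG {α : Type*} {k : ℕ} {g : Fin k → List α} {t : ℕ}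
    {L : Finset (Fin k)} {i : Fin k} (hi : i ∈ L) :
    L ∈ XtG g t ↔ t < (g i).length ∧ L = nodeG g ((g i).take (t + 1)) := by
  have hself : i ∈ nodeG g ((g i).take (t + 1)) := mem_nodeG.2 (List.take_prefix _ _)
  have hnode : nodeG g ((g i).take (t + 1)) ∈ BG g := ⟨_, ⟨i, hself⟩, rfl⟩
  have hX : L ∈ XtG g t ↔ L ∈ BG g ∧ sG g L ≤ t ∧ t < eG g L := by simp [XtG]
  rw [hX]
  constructor
  · rintro ⟨-, hs, he⟩
    obtain ⟨hlen, hsub⟩ := (le_eG_iff hi).1 (Nat.succ_le_of_lt he)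
    refine ⟨hlen, by_contra fun hne => ?_⟩
    have hss := hsub.ssubset_of_ne hne
    have hroot : L ≠ Finset.univ := (hss.trans_subset (Finset.subset_univ _)).ne
    obtain ⟨-, hLP, hleast⟩ := parentG_spec (g := g) hi hroot
    rw [sG, if_neg hroot] at hs
    have := (le_eG_iff (hLP.1 hi)).2 ⟨hlen, hleast _ hnode hss⟩
    omega
  · rintro ⟨hlen, hL⟩
    refine ⟨hL ▸ hnode, ?_, (le_eG_iff hi).2 ⟨hlen, hL.subset⟩⟩
    by_cases hroot : L = Finset.univ
    · simp [sG, hroot]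
    · obtain ⟨-, hLP, -⟩ := parentG_spec (g := g) hi hroot
      rw [sG, if_neg hroot]
      by_contra! hlt
      have hPL := ((le_eG_iff (hLP.1 hi)).1 (Nat.succ_le_of_lt hlt)).2
      exact hLP.2 (hPL.trans hL.ge)

theorem sum_XtG_filter_mem {α : Type*} {k : ℕ} (g : Fin k → List α) (t : ℕ) (i : Fin k)
    (c : ℝ) :
    ∑ L ∈ XtG g t, (if i ∈ L then c else 0) = if t < (g i).length then c else 0 := by
  have hself : i ∈ nodeG g ((g i).take (t + 1)) := mem_nodeG.2 (List.take_prefix _ _)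
  split_ifs with ht
  · rw [Finset.sum_eq_single_of_mem _ ((mem_XtG_iff_eq_nodeG hself).2 ⟨ht, rfl⟩), if_pos hself]
    exact fun L hL hne => if_neg fun hi => hne ((mem_XtG_iff_eq_nodeG hi).1 hL).2
  · exact Finset.sum_eq_zero fun L hL =>
      if_neg fun hi => ht ((mem_XtG_iff_eq_nodeG hi).1 hL).1

/-- **Double-sum rearrangement over process sets (Equation 9).** For every
`f : {1,…,k} × ℕ → ℝ`, with `t_max = max_i len(gᵢ)`:
`∑ᵢ ∑_{t<len(gᵢ)} f(i,t) = ∑_{t<t_max} ∑_{λ∈X_t} ∑_{i∈λ} f(i,t)`. -/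
theorem double_sum_rearrangement {α : Type*} {k : ℕ} (hk : 1 ≤ k)
    (g : Fin k → List α) (f : Fin k → ℕ → ℝ) :
    ∑ i, ∑ t ∈ Finset.range (g i).length, f i t =
      ∑ t ∈ Finset.range (Finset.univ.sup fun i => (g i).length),
        ∑ L ∈ XtG g t, ∑ i ∈ L, f i t := by
  have hinner (t : ℕ) : ∑ L ∈ XtG g t, ∑ i ∈ L, f i t =
      ∑ i, if t < (g i).length then f i t else 0 := by
    simp_rw [← sum_XtG_filter_mem g t]
    rw [Finset.sum_comm]
    exact Finset.sum_congr rfl fun L _ => by simp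
  simp_rw [hinner]
  rw [Finset.sum_comm]
  refine Finset.sum_congr rfl fun i _ => ?_
  rw [← Finset.sum_filter]
  refine Finset.sum_congr (Finset.ext fun t => ?_) fun _ _ => rfl
  have hle : (g i).length ≤ Finset.univ.sup fun i => (g i).length :=
    Finset.le_sup (f := fun i => (g i).length) (Finset.mem_univ i)
  simp only [Finset.mem_range, Finset.mem_filter]
  omega
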